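/- The space of derivations of the evolution algebra I_n over an algebraically closed field of characteristic zero has dimension (n−1)(n−2)/2 + 1; explicitly, a linear map D with matrix (d_{jk}) is a derivation if and only if all diagonal entries equal a common scalar d, d_{jk} = −d_{kj} for j ≠ k (for j, k ≥ 2), d_{12} = −d·i, d_{21} = d·i, d_{k2} = i·d_{k1} for k ≥ 3, d_{1k} = −d_{k1} for k ≥ 3, and d_{2k} = −d_{k2} for k ≥ 3. -/

import Mathlib

open Module

/-- The evolution algebra `I_n` on `Fin (n+2) → F`: `eₖ² = e₀ + I·e₁` (`I² = -1`),
`eₖeₗ = 0` for `k ≠ l`. -/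
def inMul {F : Type*} [Field F] {n : ℕ} (I : F) (x y : Fin (n + 2) → F) :
    Fin (n + 2) → F :=
  fun k => if k = 0 then ∑ i, x i * y i
    else if k = 1 then I * ∑ i, x i * y i else 0

lemma inMul_add_left {F : Type*} [Field F] {n : ℕ} (I : F) (x x' y : Fin (n + 2) → F) :
    inMul I (x + x') y = inMul I x y + inMul I x' y := by
  funext k
  simp only [inMul, Pi.add_apply]
  split
  · rw [← Finset.sum_add_distrib]
    exact Finset.sum_congr rfl fun i _ => by ring
  · split
    · rw [← mul_add, ← Finset.sum_add_distrib]
      congr 1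
      exact Finset.sum_congr rfl fun i _ => by ring
    · simp

lemma inMul_add_right {F : Type*} [Field F] {n : ℕ} (I : F) (x y y' : Fin (n + 2) → F) :
    inMul I x (y + y') = inMul I x y + inMul I x y' := by
  funext k
  simp only [inMul, Pi.add_apply]
  split
  · rw [← Finset.sum_add_distrib]
    exact Finset.sum_congr rfl fun i _ => by ring
  · split
    · rw [← mul_add, ← Finset.sum_add_distrib]
      congr 1
      exact Finset.sum_congr rfl fun i _ => by ring
    · simp

lemma inMul_smul_left {F : Type*} [Field F] {n : ℕ} (I c : F) (x y : Fin (n + 2) → F) :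
    inMul I (c • x) y = c • inMul I x y := by
  funext k
  simp only [inMul, Pi.smul_apply, smul_eq_mul]
  split
  · rw [Finset.mul_sum]
    exact Finset.sum_congr rfl fun i _ => by ring
  · split
    · rw [Finset.mul_sum, Finset.mul_sum, Finset.mul_sum]
      exact Finset.sum_congr rfl fun i _ => by ring
    · simp

lemma inMul_smul_right {F : Type*} [Field F] {n : ℕ} (I c : F) (x y : Fin (n + 2) → F) :
    inMul I x (c • y) = c • inMul I x y := by
  funext k
  simp only [inMul, Pi.smul_apply, smul_eq_mul]
  split
  · rw [Finset.mul_sum]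
    exact Finset.sum_congr rfl fun i _ => by ring
  · split
    · rw [Finset.mul_sum, Finset.mul_sum, Finset.mul_sum]
      exact Finset.sum_congr rfl fun i _ => by ring
    · simp

/-- The space of derivations of `I_n`. -/
def inDer (F : Type*) [Field F] (n : ℕ) (I : F) :
    Submodule F ((Fin (n + 2) → F) →ₗ[F] (Fin (n + 2) → F)) where
  carrier := {D | ∀ x y, D (inMul I x y) = inMul I (D x) y + inMul I x (D y)}
  add_mem' := by
    intro a b ha hb x y
    simp only [LinearMap.add_apply, ha x y, hb x y, inMul_add_left, inMul_add_right]
    abel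
  zero_mem' := by
    intro x y
    have h1 : ∀ z : Fin (n + 2) → F, inMul (n := n) I 0 z = 0 := by
      intro z; funext k; simp [inMul]
    have h2 : ∀ z : Fin (n + 2) → F, inMul (n := n) I z 0 = 0 := by
      intro z; funext k; simp [inMul]
    simp [h1, h2]
  smul_mem' := by
    intro c D hD x y
    simp only [LinearMap.smul_apply, hD x y, inMul_smul_left, inMul_smul_right, smul_add]

/-- The common square `e₀ + I·e₁` of the basis vectors of `I_n`. -/
def inSq {F : Type*} [Field F] (n : ℕ) (I : F) : Fin (n + 2) → F :=
  Pi.single 0 1 + I • Pi.single 1 1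

lemma inMul_eq_smul {F : Type*} [Field F] {n : ℕ} (I : F) (x y : Fin (n + 2) → F) :
    inMul I x y = (x ⬝ᵥ y) • inSq n I := by
  funext k
  by_cases h0 : k = 0
  · simp [inMul, inSq, dotProduct, h0]
  · by_cases h1 : k = 1
    · simp [inMul, inSq, dotProduct, h1, mul_comm]
    · simp [inMul, inSq, h0, h1]

lemma inSq_zero {F : Type*} [Field F] (n : ℕ) (I : F) : inSq n I 0 = 1 := by
  simp [inSq]

lemma derivation_iff_matrix {F : Type*} [Field F] [CharZero F] {n : ℕ} (I : F)
    (D : (Fin (n + 2) → F) →ₗ[F] (Fin (n + 2) → F)) :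
    (∀ x y, D (inMul I x y) = inMul I (D x) y + inMul I x (D y)) ↔
      ∃ d : F, D (inSq n I) = (2 * d) • inSq n I ∧
        ∀ j k, D (Pi.single k 1) j + D (Pi.single j 1) k = if j = k then 2 * d else 0 := by
  simp only [inMul_eq_smul, map_smul, ← add_smul]
  constructor
  · intro h
    have hsq : D (inSq n I) = (2 * D (Pi.single 0 1) 0) • inSq n I := by
      simpa [← two_mul] using h (Pi.single 0 1) (Pi.single 0 1)
    refine ⟨_, hsq, fun j k => ?_⟩
    have := congrFun (h (Pi.single k 1) (Pi.single j 1)) 0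
    rw [hsq] at this
    simp only [Pi.smul_apply, inSq_zero, dotProduct_single_one, single_one_dotProduct,
      smul_eq_mul, mul_one, Pi.single_apply] at this
    rw [← this]
    split <;> simp
  · rintro ⟨d, hsq, hsymm⟩ x y
    set M := LinearMap.toMatrix' D with hM
    have hD : ∀ z, D z = M.mulVec z := fun z => (LinearMap.toMatrix'_mulVec D z).symm
    have hT : M + M.transpose = (2 * d) • (1 : Matrix _ _ F) := by
      ext j k
      simpa [hM, LinearMap.toMatrix'_apply, Matrix.one_apply] using hsymm j k
    have key : D x ⬝ᵥ y + x ⬝ᵥ D y = (2 * d) * (x ⬝ᵥ y) := by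
      rw [hD, hD, ← Matrix.vecMul_transpose, ← Matrix.dotProduct_mulVec, ← dotProduct_add,
        ← Matrix.add_mulVec, add_comm M.transpose, hT, Matrix.smul_mulVec, Matrix.one_mulVec,
        dotProduct_smul, smul_eq_mul]
    rw [key, hsq, smul_smul, mul_comm]

lemma derivation_iff_entries {F : Type*} [Field F] [CharZero F] {n : ℕ} {I : F}
    (hI : I ^ 2 = -1) (D : (Fin (n + 2) → F) →ₗ[F] (Fin (n + 2) → F)) :
    (∀ x y, D (inMul I x y) = inMul I (D x) y + inMul I x (D y)) ↔
      (∃ d : F,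
        (∀ j : Fin (n + 2), D (Pi.single j 1) j = d) ∧
        D (Pi.single 1 1) 0 = -(d * I) ∧
        D (Pi.single 0 1) 1 = d * I ∧
        (∀ j k : Fin (n + 2), j ≠ k → j ≠ 0 → k ≠ 0 →
          D (Pi.single k 1) j = - D (Pi.single j 1) k) ∧
        (∀ k : Fin (n + 2), k ≠ 0 → k ≠ 1 →
          D (Pi.single 1 1) k = I * D (Pi.single 0 1) k) ∧
        (∀ k : Fin (n + 2), k ≠ 0 → k ≠ 1 →
          D (Pi.single k 1) 0 = - D (Pi.single 0 1) k ∧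
          D (Pi.single k 1) 1 = - D (Pi.single 1 1) k)) := by
  have hsq : D (inSq n I) = D (Pi.single 0 1) + I • D (Pi.single 1 1) := by simp [inSq]
  rw [derivation_iff_matrix, hsq]
  constructor
  · rintro ⟨d, hu, hs⟩
    have hdiag : ∀ j, D (Pi.single j 1) j = d := fun j => by
      have := hs j j
      rw [if_pos rfl, ← two_mul] at this
      exact mul_left_cancel₀ two_ne_zero this
    have hanti : ∀ j k, j ≠ k → D (Pi.single k 1) j = - D (Pi.single j 1) k := fun j k hjk => by
      have := hs j k
      rw [if_neg hjk] at this
      exact eq_neg_of_add_eq_zero_left this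
    have h1 := congrFun hu 1
    simp only [Pi.add_apply, Pi.smul_apply, smul_eq_mul, hdiag] at h1
    have hu1 : inSq n I 1 = I := by simp [inSq]
    rw [hu1] at h1
    have h10 : D (Pi.single 0 1) 1 = d * I := by linear_combination h1
    refine ⟨d, hdiag, by rw [hanti 0 1 (by simp), h10], h10, fun j k h _ _ => hanti j k h,
      fun k h0 h1 => ?_, fun k h0 h1 => ⟨hanti _ _ h0.symm, hanti _ _ h1.symm⟩⟩
    have hk := congrFun hu k
    have huk : inSq n I k = 0 := by simp [inSq, h0, h1]
    simp only [Pi.add_apply, Pi.smul_apply, smul_eq_mul, huk] at hk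
    linear_combination (-I) * hk + D (Pi.single 1 1) k * hI
  · rintro ⟨d, hdiag, h01, h10, hanti, hcol, hrow⟩
    refine ⟨d, ?_, fun j k => ?_⟩
    · funext k
      simp only [Pi.add_apply, Pi.smul_apply, smul_eq_mul]
      by_cases h0 : k = 0
      · subst h0
        rw [hdiag, h01, inSq_zero]
        linear_combination (-d) * hI
      · by_cases h1 : k = 1
        · subst h1
          rw [hdiag, h10]
          simp [inSq]
          ring
        · rw [hcol k h0 h1]
          simp [inSq, h0, h1]
          linear_combination D (Pi.single 0 1) k * hI
    · split_ifs with h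
      · subst h
        rw [hdiag, two_mul]
      · have hzero : ∀ m : Fin (n + 2), m ≠ 0 →
            D (Pi.single m 1) 0 + D (Pi.single 0 1) m = 0 := fun m hm => by
          by_cases h1 : m = 1
          · subst h1
            rw [h01, h10]
            ring
          · rw [(hrow m hm h1).1]
            ring
        by_cases hj : j = 0
        · subst hj
          exact hzero k (Ne.symm h)
        · by_cases hk : k = 0
          · subst hk
            rw [add_comm]
            exact hzero j hj
          · rw [hanti j k h hj hk]
            ring

/-- The alternating matrix with prescribed entries above the diagonal. -/
def altMatrix {F : Type*} [Field F] {m : ℕ} (f : {p : Fin m × Fin m // p.1 < p.2} → F) :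
    Matrix (Fin m) (Fin m) F :=
  fun i j => if h : i < j then f ⟨(i, j), h⟩ else if h : j < i then -f ⟨(j, i), h⟩ else 0

lemma altMatrix_antisymm {F : Type*} [Field F] {m : ℕ}
    (f : {p : Fin m × Fin m // p.1 < p.2} → F) (i j : Fin m) :
    altMatrix f i j = -altMatrix f j i := by
  rcases lt_trichotomy i j with h | h | h
  · simp [altMatrix, h, h.not_gt]
  · simp [altMatrix, h]
  · simp [altMatrix, h, h.not_gt]

/-- The matrix of the derivation of `I_n` with diagonal entry `c` and off-diagonal entries `B`
on the indices different from `0`. -/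
def derMatrix {F : Type*} [Field F] {n : ℕ} (I c : F) (B : Matrix (Fin (n + 1)) (Fin (n + 1)) F) :
    Matrix (Fin (n + 2)) (Fin (n + 2)) F :=
  fun j k =>
    Fin.cases (Fin.cases c (fun b => if b = 0 then -(c * I) else I * B b 0) k)
      (fun a => Fin.cases (if a = 0 then c * I else -(I * B a 0))
        (fun b => if a = b then c else B a b) k) j

lemma derMatrix_mem {F : Type*} [Field F] [CharZero F] {n : ℕ} {I : F} (hI : I ^ 2 = -1) (c : F)
    {B : Matrix (Fin (n + 1)) (Fin (n + 1)) F} (hB : ∀ i j, B i j = -B j i) :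
    Matrix.toLin' (derMatrix I c B) ∈ inDer F n I := by
  refine (derivation_iff_entries hI _).2 ⟨c, ?_⟩
  simp only [Matrix.toLin'_apply, Matrix.mulVec_single_one, Matrix.col_apply,
    Fin.forall_fin_succ (n := n + 1), ← Fin.succ_zero_eq_one]
  simp only [derMatrix, Fin.cases_zero, Fin.cases_succ, Fin.succ_inj, Fin.succ_ne_zero, ne_eq]
  refine ⟨⟨trivial, by simp⟩, by simp, by simp, ?_, ?_, ?_⟩
  · simp only [not_true_eq_false, false_implies, implies_true, true_and, not_false_eq_true,
      forall_const]
    intro a b hab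
    simp [hab, Ne.symm hab, ← hB]
  · simp only [not_true_eq_false, false_implies, true_and]
    intro a _ ha
    simp only [ha, if_false]
    linear_combination B a 0 * hI
  · simp only [not_true_eq_false, false_implies, true_and]
    intro a _ ha
    simp [ha, Ne.symm ha, ← hB]

/-- A derivation of `I_n` as its first diagonal entry together with its entries above the
diagonal on the indices different from `0`. -/
def derCoords (F : Type*) [Field F] (n : ℕ) (I : F) :
    inDer F n I →ₗ[F] F × ({p : Fin (n + 1) × Fin (n + 1) // p.1 < p.2} → F) where
  toFun D := (D.1 (Pi.single 0 1) 0, fun p => D.1 (Pi.single p.1.2.succ 1) p.1.1.succ)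
  map_add' _ _ := rfl
  map_smul' _ _ := rfl

lemma derCoords_injective {F : Type*} [Field F] [CharZero F] {n : ℕ} {I : F}
    (hI : I ^ 2 = -1) : Function.Injective (derCoords F n I) := by
  rw [injective_iff_map_eq_zero]
  rintro ⟨D, hD⟩ h
  obtain ⟨d, hdiag, h01, h10, hanti, hcol, hrow⟩ := (derivation_iff_entries hI D).1 hD
  have hd : d = 0 := by rw [← hdiag 0]; exact congrArg Prod.fst h
  subst hd
  have hup : ∀ a b : Fin (n + 1), a < b → D (Pi.single b.succ 1) a.succ = 0 :=
    fun a b hab => congrFun (congrArg Prod.snd h) ⟨(a, b), hab⟩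
  have hblock : ∀ a b : Fin (n + 1), D (Pi.single b.succ 1) a.succ = 0 := fun a b => by
    rcases lt_trichotomy a b with hab | hab | hab
    · exact hup a b hab
    · rw [hab, hdiag]
    · rw [hanti _ _ (by simpa using hab.ne') (Fin.succ_ne_zero _) (Fin.succ_ne_zero _),
        hup b a hab, neg_zero]
  have hI0 : I ≠ 0 := by
    rintro rfl
    simp at hI
  have hcol0 : ∀ a : Fin (n + 1), D (Pi.single 0 1) a.succ = 0 := fun a => by
    by_cases ha : a = 0
    · rw [ha, Fin.succ_zero_eq_one, h10, zero_mul]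
    · have := hcol a.succ (Fin.succ_ne_zero _) (by rwa [← Fin.succ_zero_eq_one, Ne, Fin.succ_inj])
      rw [← Fin.succ_zero_eq_one, hblock] at this
      exact (mul_eq_zero.1 this.symm).resolve_left hI0
  have hrow0 : ∀ b : Fin (n + 1), D (Pi.single b.succ 1) 0 = 0 := fun b => by
    by_cases hb : b = 0
    · rw [hb, Fin.succ_zero_eq_one, h01, zero_mul, neg_zero]
    · rw [(hrow b.succ (Fin.succ_ne_zero _) (by rwa [← Fin.succ_zero_eq_one, Ne, Fin.succ_inj])).1,
        hcol0, neg_zero]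
  refine Subtype.ext (LinearMap.toMatrix'.injective ?_)
  ext j k
  simp only [LinearMap.toMatrix'_apply, Submodule.coe_zero, LinearMap.zero_apply, Pi.zero_apply]
  cases j using Fin.cases <;> cases k using Fin.cases
  · exact hdiag 0
  · exact hrow0 _
  · exact hcol0 _
  · exact hblock _ _

lemma derCoords_surjective {F : Type*} [Field F] [CharZero F] {n : ℕ} {I : F}
    (hI : I ^ 2 = -1) : Function.Surjective (derCoords F n I) := by
  rintro ⟨c, f⟩
  refine ⟨⟨_, derMatrix_mem hI c (altMatrix_antisymm f)⟩, Prod.ext ?_ (funext fun p => ?_)⟩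
  · simp [derCoords, derMatrix]
  · simp [derCoords, derMatrix, altMatrix, p.2, p.2.ne]

lemma card_lt_pairs (m : ℕ) :
    Fintype.card {p : Fin m × Fin m // p.1 < p.2} = m * (m - 1) / 2 := by
  rw [← Finset.sum_range_id_mul_two, Nat.mul_div_cancel _ two_pos, Fintype.card_subtype,
    Finset.card_filter, Fintype.sum_prod_type_right, ← Fin.sum_univ_eq_sum_range]
  refine Finset.sum_congr rfl fun b _ => ?_
  rw [← Finset.card_filter, Finset.filter_gt_eq_Iio, Fin.card_Iio]

lemma finrank_inDer {F : Type*} [Field F] [CharZero F] (n : ℕ) {I : F} (hI : I ^ 2 = -1) :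
    finrank F (inDer F n I) = (n + 1) * n / 2 + 1 := by
  rw [(LinearEquiv.ofBijective (derCoords F n I)
    ⟨derCoords_injective hI, derCoords_surjective hI⟩).finrank_eq, finrank_prod, finrank_self,
    finrank_fintype_fun_eq_card, card_lt_pairs, add_comm, Nat.add_sub_cancel]

/-- **Derivations of `I_n`.** Over an algebraically closed field of characteristic zero,
a linear map `D` with matrix `(d j k) = D(eₖ) j` is a derivation of `I_n` iff all
diagonal entries equal a common scalar `d`, `d₀₁ = -d·I`, `d₁₀ = d·I`, the block with
indices `≥ 1` is antisymmetric off the diagonal, `d_{k1} = I·d_{k0}` for `k ≥ 2`, and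
the first two rows satisfy `d₀ₖ = -d_{k0}`, `d₁ₖ = -d_{k1}` for `k ≥ 2`.
Consequently `dim Der(I_n) = (n-1)(n-2)/2 + 1` (here the dimension is `n + 2`). -/
theorem stmt_10 (F : Type*) [Field F] [IsAlgClosed F] [CharZero F]
    (I : F) (hI : I ^ 2 = -1) (n : ℕ)
    (D : (Fin (n + 2) → F) →ₗ[F] (Fin (n + 2) → F)) :
    ((∀ x y, D (inMul I x y) = inMul I (D x) y + inMul I x (D y)) ↔
      (∃ d : F,
        (∀ j : Fin (n + 2), D (Pi.single j 1) j = d) ∧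
        D (Pi.single 1 1) 0 = -(d * I) ∧
        D (Pi.single 0 1) 1 = d * I ∧
        (∀ j k : Fin (n + 2), j ≠ k → j ≠ 0 → k ≠ 0 →
          D (Pi.single k 1) j = - D (Pi.single j 1) k) ∧
        (∀ k : Fin (n + 2), k ≠ 0 → k ≠ 1 →
          D (Pi.single 1 1) k = I * D (Pi.single 0 1) k) ∧
        (∀ k : Fin (n + 2), k ≠ 0 → k ≠ 1 →
          D (Pi.single k 1) 0 = - D (Pi.single 0 1) k ∧
          D (Pi.single k 1) 1 = - D (Pi.single 1 1) k))) ∧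
    finrank F (inDer F n I) = ((n + 2) - 1) * ((n + 2) - 2) / 2 + 1 := by
  exact ⟨derivation_iff_entries hI D, finrank_inDer n hI⟩
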